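/- Every density-evolution fixed point is a stationary point of the potential: if x ∈ X satisfies x = c ⊛ λ^⊛(ρ^⊠(x)), then for every y ∈ X_d the directional derivative d_x U(x; c)[y] exists and equals 0. -/

import Mathlib

open MeasureTheory Real Filter Topology Polynomial

noncomputable section

/-- The space of finite signed Borel measures on the extended reals `ℝ̄`. -/
abbrev SM := MeasureTheory.SignedMeasure EReal

namespace SCLDPC

/-- The weight `e^{-α/2}` as an extended nonnegative real (`+∞` at `α = -∞`). -/
def wt (α : EReal) : ENNReal :=
  if α = ⊥ then ⊤ else if α = ⊤ then 0 else ENNReal.ofReal (Real.exp (-(α.toReal) / 2))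

/-- A (nonnegative) Borel measure `μ` on `ℝ̄` is symmetric if
`∫_{-E} e^{-α/2} μ(dα) = ∫_{E} e^{-α/2} μ(dα)` for every Borel set `E`
(stated with extended nonnegative integrals, which is equivalent to requiring
equality whenever one of the two sides is finite). -/
def IsSymmMeasure (μ : Measure EReal) : Prop :=
  ∀ E : Set EReal, MeasurableSet E →
    ∫⁻ α in (fun a : EReal => -a) ⁻¹' E, wt α ∂μ = ∫⁻ α in E, wt α ∂μ

/-- Positive part of the Jordan decomposition. -/
def jp (x : SM) : Measure EReal := x.toJordanDecomposition.posPart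

/-- Negative part of the Jordan decomposition. -/
def jn (x : SM) : Measure EReal := x.toJordanDecomposition.negPart

instance (x : SM) : IsFiniteMeasure (jp x) := x.toJordanDecomposition.posPart_finite

instance (x : SM) : IsFiniteMeasure (jn x) := x.toJordanDecomposition.negPart_finite

/-- A finite signed Borel measure on `ℝ̄` is symmetric iff both parts of its Jordan
decomposition are symmetric measures. -/
def IsSymm (x : SM) : Prop := IsSymmMeasure (jp x) ∧ IsSymmMeasure (jn x)

/-- Membership in `X`, the set of symmetric probability measures on `ℝ̄`. -/
def MemX (x : SM) : Prop :=
  (∃ (μ : Measure EReal) (hμ : IsProbabilityMeasure μ),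
      x = (letI := hμ; μ.toSignedMeasure)) ∧ IsSymm x

/-- Membership in `X_d`, the set of differences of symmetric probability measures. -/
def MemXd (y : SM) : Prop := ∃ x1 x2 : SM, MemX x1 ∧ MemX x2 ∧ y = x1 - x2

/-- Integral of a real function against a finite signed measure. -/
def sInt (f : EReal → ℝ) (x : SM) : ℝ := (∫ α, f α ∂(jp x)) - ∫ α, f α ∂(jn x)

/-- `tanh(α/2)` extended continuously to `ℝ̄`. -/
def tanhHalf (α : EReal) : ℝ :=
  if α = ⊤ then 1 else if α = ⊥ then -1 else Real.tanh (α.toReal / 2)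

/-- The inverse hyperbolic tangent on `(-1, 1)`. -/
def artanh (t : ℝ) : ℝ := Real.log ((1 + t) / (1 - t)) / 2

/-- `2 tanh⁻¹(t)` valued in `ℝ̄` (sending `t ≥ 1` to `+∞` and `t ≤ -1` to `-∞`). -/
def atanhTwo (t : ℝ) : EReal :=
  if 1 ≤ t then ⊤ else if t ≤ -1 then ⊥ else ((2 * artanh t : ℝ) : EReal)

/-- Variable-node convolution `⊛` of two (nonnegative) measures:
`(μ ⊛ ν)(E) = ∫ μ(E - α) ν(dα)`, i.e. the pushforward of `μ × ν` under addition. -/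
def mConv (μ ν : Measure EReal) : Measure EReal :=
  (μ.prod ν).map fun p => p.1 + p.2

/-- Check-node convolution `⊠` of two (nonnegative) measures:
`(μ ⊠ ν)(E) = ∫ μ(2 tanh⁻¹(tanh(E/2) / tanh(α/2))) ν(dα)`, where the argument of `μ`
is the image of `E` under `β ↦ 2 tanh⁻¹(tanh(β/2) / tanh(α/2))`; equivalently, the
pushforward of `μ × ν` under `(β, α) ↦ 2 tanh⁻¹(tanh(β/2) · tanh(α/2))`. -/
def mCheck (μ ν : Measure EReal) : Measure EReal :=
  (μ.prod ν).map fun p => atanhTwo (tanhHalf p.1 * tanhHalf p.2)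

instance (μ ν : Measure EReal) [IsFiniteMeasure μ] [IsFiniteMeasure ν] :
    IsFiniteMeasure (mConv μ ν) := by unfold mConv; infer_instance

instance (μ ν : Measure EReal) [IsFiniteMeasure μ] [IsFiniteMeasure ν] :
    IsFiniteMeasure (mCheck μ ν) := by unfold mCheck; infer_instance

/-- The variable-node operation `⊛` extended bilinearly to finite signed measures. -/
def sConv (x y : SM) : SM :=
  (mConv (jp x) (jp y)).toSignedMeasure - (mConv (jp x) (jn y)).toSignedMeasure
    - (mConv (jn x) (jp y)).toSignedMeasure + (mConv (jn x) (jn y)).toSignedMeasure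

/-- The check-node operation `⊠` extended bilinearly to finite signed measures. -/
def sCheck (x y : SM) : SM :=
  (mCheck (jp x) (jp y)).toSignedMeasure - (mCheck (jp x) (jn y)).toSignedMeasure
    - (mCheck (jn x) (jp y)).toSignedMeasure + (mCheck (jn x) (jn y)).toSignedMeasure

/-- The integrand `log₂(1 + e^{-α})` of the entropy functional (with the harmless
convention that it vanishes at `α = ±∞`; symmetric measures put no mass at `-∞`). -/
def entFn (α : EReal) : ℝ :=
  if α = ⊤ then 0 else if α = ⊥ then 0 else Real.logb 2 (1 + Real.exp (-(α.toReal)))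

/-- The entropy functional `H(x) = ∫ log₂(1 + e^{-α}) x(dα)`. -/
def H (x : SM) : ℝ := sInt entFn x

/-- `Δ_0`, the unit point mass at `0`. -/
def d0 : SM := (Measure.dirac (0 : EReal)).toSignedMeasure

/-- `Δ_∞`, the unit point mass at `+∞`. -/
def dTop : SM := (Measure.dirac (⊤ : EReal)).toSignedMeasure

/-- `x^{⊛n}` with `x^{⊛0} = Δ_0`. -/
def convPow (x : SM) : ℕ → SM
  | 0 => d0
  | n + 1 => sConv (convPow x n) x

/-- `x^{⊠n}` with `x^{⊠0} = Δ_∞`. -/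
def checkPow (x : SM) : ℕ → SM
  | 0 => dTop
  | n + 1 => sCheck (checkPow x n) x

/-- `p^{⊛}(x) = Σ_n p_n x^{⊛n}` for a real polynomial `p`. -/
def polyConv (p : Polynomial ℝ) (x : SM) : SM :=
  ∑ n ∈ Finset.range (p.natDegree + 1), p.coeff n • convPow x n

/-- `p^{⊠}(x) = Σ_n p_n x^{⊠n}` for a real polynomial `p`. -/
def polyCheck (p : Polynomial ℝ) (x : SM) : SM :=
  ∑ n ∈ Finset.range (p.natDegree + 1), p.coeff n • checkPow x n

/-- The single-system potential functional `U(x; c)` of the LDPC(λ, ρ) ensemble: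
`U(x; c) = (L'(1)/R'(1)) H(R^⊠(x)) + L'(1) H(ρ^⊠(x)) - L'(1) H(x ⊠ ρ^⊠(x))
  - H(c ⊛ L^⊛(ρ^⊠(x)))`. -/
def potU (rho L R : Polynomial ℝ) (x c : SM) : ℝ :=
  (derivative L).eval 1 / (derivative R).eval 1 * H (polyCheck R x)
    + (derivative L).eval 1 * H (polyCheck rho x)
    - (derivative L).eval 1 * H (sCheck x (polyCheck rho x))
    - H (sConv c (polyConv L (polyCheck rho x)))

/-! ### Pointwise facts -/

/-- The weight `1 + e^{-α}`. -/
def vf (α : EReal) : ENNReal := 1 + wt α * wt α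

/-- The check-node map. -/
def chk (p : EReal × EReal) : EReal := atanhTwo (tanhHalf p.1 * tanhHalf p.2)

/-- The variable-node map. -/
def add2 (p : EReal × EReal) : EReal := p.1 + p.2

lemma wt_meas : Measurable wt := by
  unfold wt
  refine Measurable.ite (measurableSet_singleton _) measurable_const
    (Measurable.ite (measurableSet_singleton _) measurable_const ?_)
  have := measurable_ereal_toReal
  fun_prop

lemma vf_meas : Measurable vf := by
  have := wt_meas
  unfold vf
  fun_prop

lemma tanhHalf_meas : Measurable tanhHalf := by
  unfold tanhHalf
  refine Measurable.ite (measurableSet_singleton _) measurable_const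
    (Measurable.ite (measurableSet_singleton _) measurable_const ?_)
  have := measurable_ereal_toReal
  have h2 : Measurable Real.tanh := by
    have : Real.tanh = fun x => Real.sinh x / Real.cosh x := by
      funext x; exact Real.tanh_eq_sinh_div_cosh x
    rw [this]
    exact Real.measurable_sinh.div Real.measurable_cosh
  exact h2.comp (this.div_const 2)

lemma atanhTwo_meas : Measurable atanhTwo := by
  unfold atanhTwo artanh
  refine Measurable.ite measurableSet_Ici measurable_const
    (Measurable.ite measurableSet_Iic measurable_const ?_)
  refine measurable_coe_real_ereal.comp ?_
  fun_prop

lemma entFn_meas : Measurable entFn := by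
  unfold entFn Real.logb
  refine Measurable.ite (measurableSet_singleton _) measurable_const
    (Measurable.ite (measurableSet_singleton _) measurable_const ?_)
  have := measurable_ereal_toReal
  fun_prop

lemma chk_meas : Measurable chk := by
  unfold chk
  exact atanhTwo_meas.comp ((tanhHalf_meas.comp measurable_fst).mul
    (tanhHalf_meas.comp measurable_snd))

lemma add2_meas : Measurable add2 := by
  unfold add2
  exact measurable_fst.add measurable_snd

lemma wt_coe (a : ℝ) : wt (a : EReal) = ENNReal.ofReal (Real.exp (-a / 2)) := by
  simp [wt]

lemma vf_coe (a : ℝ) : vf (a : EReal) = ENNReal.ofReal (1 + Real.exp (-a)) := by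
  rw [vf, wt_coe, ← ENNReal.ofReal_mul (by positivity), ← Real.exp_add,
    ENNReal.ofReal_add (by positivity) (by positivity), ENNReal.ofReal_one]
  congr 3; ring_nf

lemma vf_top : vf ⊤ = 1 := by simp [vf, wt]
lemma vf_bot : vf ⊥ = ⊤ := by simp [vf, wt]
lemma one_le_vf (a : EReal) : 1 ≤ vf a := by simp [vf]

lemma tanhHalf_coe (a : ℝ) :
    tanhHalf (a : EReal) = (1 - Real.exp (-a)) / (1 + Real.exp (-a)) := by
  simp only [tanhHalf, EReal.coe_ne_top, EReal.coe_ne_bot, if_false, EReal.toReal_coe]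
  rw [Real.tanh_eq_sinh_div_cosh, Real.sinh_eq, Real.cosh_eq]
  have h : Real.exp (-a) = Real.exp (-(a/2)) * Real.exp (-(a/2)) := by
    rw [← Real.exp_add]; ring_nf
  have h2 : Real.exp (a/2) * Real.exp (-(a/2)) = 1 := by
    rw [← Real.exp_add]; simp
  rw [h]
  have := Real.exp_pos (a/2)
  have := Real.exp_pos (-(a/2))
  rw [div_eq_div_iff (by positivity) (by positivity)]
  generalize Real.exp (a/2) = u at *
  generalize Real.exp (-(a/2)) = v at *
  linear_combination v * h2

lemma tanhHalf_top : tanhHalf ⊤ = 1 := by simp [tanhHalf]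
lemma tanhHalf_bot : tanhHalf ⊥ = -1 := by simp [tanhHalf]

lemma tanhHalf_coe_lt (a : ℝ) : tanhHalf (a : EReal) < 1 ∧ -1 < tanhHalf (a : EReal) := by
  rw [tanhHalf_coe]
  have := Real.exp_pos (-a)
  constructor
  · rw [div_lt_one (by positivity)]; linarith
  · rw [lt_div_iff₀ (by positivity)]; linarith

lemma tanhHalf_mem (a : EReal) : tanhHalf a ≤ 1 ∧ -1 ≤ tanhHalf a := by
  induction a with
  | bot => simp [tanhHalf_bot]
  | top => simp [tanhHalf_top]
  | coe a => exact ⟨(tanhHalf_coe_lt a).1.le, (tanhHalf_coe_lt a).2.le⟩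

lemma atanhTwo_of_lt {t : ℝ} (h1 : t < 1) (h2 : -1 < t) :
    atanhTwo t = ((Real.log ((1 + t) / (1 - t)) : ℝ) : EReal) := by
  rw [atanhTwo, if_neg (not_le.2 h1), if_neg (not_le.2 h2), artanh]
  congr 1; ring

lemma exp_neg_log_aux {t : ℝ} (h1 : t < 1) (h2 : -1 < t) :
    Real.exp (-Real.log ((1 + t) / (1 - t))) = (1 - t) / (1 + t) := by
  have : 0 < (1 + t) / (1 - t) := div_pos (by linarith) (by linarith)
  rw [Real.exp_neg, Real.exp_log this, inv_div]

lemma tanhHalf_atanhTwo {t : ℝ} (h1 : t ≤ 1) (h2 : -1 ≤ t) : tanhHalf (atanhTwo t) = t := by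
  rcases h1.eq_or_lt with rfl | h1
  · simp [atanhTwo, tanhHalf]
  rcases h2.eq_or_lt with rfl | h2
  · rw [atanhTwo, if_neg (by norm_num), if_pos le_rfl, tanhHalf_bot]
  rw [atanhTwo_of_lt h1 h2, tanhHalf_coe, exp_neg_log_aux h1 h2]
  have : 0 < 1 + t := by linarith
  field_simp
  ring

lemma atanhTwo_tanhHalf (a : EReal) : atanhTwo (tanhHalf a) = a := by
  induction a with
  | bot => rw [tanhHalf_bot, atanhTwo, if_neg (by norm_num), if_pos le_rfl]
  | top => simp [atanhTwo, tanhHalf]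
  | coe a =>
    rw [atanhTwo_of_lt (tanhHalf_coe_lt a).1 (tanhHalf_coe_lt a).2, tanhHalf_coe]
    congr 1
    have h := Real.exp_pos (-a)
    have : (1 + (1 - Real.exp (-a)) / (1 + Real.exp (-a))) /
        (1 - (1 - Real.exp (-a)) / (1 + Real.exp (-a))) = (Real.exp (-a))⁻¹ := by
      have h3 : 1 - (1 - Real.exp (-a)) / (1 + Real.exp (-a))
        = 2 * Real.exp (-a) / (1 + Real.exp (-a)) := by field_simp; ring
      rw [h3]
      field_simp
      ring
    rw [this, ← Real.exp_neg, Real.log_exp, neg_neg]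

lemma mul_mem_aux {s t : ℝ} (hs : s ≤ 1 ∧ -1 ≤ s) (ht : t ≤ 1 ∧ -1 ≤ t) :
    s * t ≤ 1 ∧ -1 ≤ s * t := by
  have h1 : 0 ≤ 1 - s := by linarith [hs.1]
  have h2 : 0 ≤ 1 + s := by linarith [hs.2]
  have h3 : 0 ≤ 1 - t := by linarith [ht.1]
  have h4 : 0 ≤ 1 + t := by linarith [ht.2]
  constructor
  · linarith [mul_nonneg h1 h4, mul_nonneg h2 h3]
  · linarith [mul_nonneg h1 h3, mul_nonneg h2 h4]

lemma tanhHalf_chk (p : EReal × EReal) : tanhHalf (chk p) = tanhHalf p.1 * tanhHalf p.2 :=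
  have h := mul_mem_aux (tanhHalf_mem p.1) (tanhHalf_mem p.2)
  tanhHalf_atanhTwo h.1 h.2

lemma chk_comm (a b : EReal) : chk (a, b) = chk (b, a) := by
  simp only [chk, mul_comm]

lemma chk_assoc (a b c : EReal) : chk (chk (a, b), c) = chk (a, chk (b, c)) := by
  have h : ∀ p : EReal × EReal, chk p = atanhTwo (tanhHalf p.1 * tanhHalf p.2) := fun _ => rfl
  rw [h (chk (a, b), c), h (a, chk (b, c))]
  simp only [tanhHalf_chk, mul_assoc]

lemma chk_top (a : EReal) : chk (⊤, a) = a := by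
  simp [chk, tanhHalf_top, atanhTwo_tanhHalf]

/-- The value of `chk` at finite points. -/
lemma chk_coe (a b : ℝ) : ∃ r : ℝ, chk ((a : EReal), (b : EReal)) = (r : EReal) ∧
    1 + Real.exp (-r) =
      (1 + Real.exp (-a)) * (1 + Real.exp (-b)) / (1 + Real.exp (-a) * Real.exp (-b)) := by
  obtain ⟨ha1, ha2⟩ := tanhHalf_coe_lt a
  obtain ⟨hb1, hb2⟩ := tanhHalf_coe_lt b
  have h1 : tanhHalf a * tanhHalf b < 1 := by nlinarith
  have h2 : -1 < tanhHalf a * tanhHalf b := by nlinarith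
  refine ⟨_, atanhTwo_of_lt h1 h2, ?_⟩
  simp only at *
  rw [exp_neg_log_aux h1 h2]
  have h0 : 0 < 1 + tanhHalf a * tanhHalf b := by linarith
  have e : 1 + (1 - tanhHalf a * tanhHalf b) / (1 + tanhHalf a * tanhHalf b)
    = 2 / (1 + tanhHalf a * tanhHalf b) := by field_simp; ring
  rw [e, div_eq_div_iff h0.ne' (by positivity), tanhHalf_coe, tanhHalf_coe]
  have := Real.exp_pos (-a)
  have := Real.exp_pos (-b)
  field_simp
  ring

lemma vf_add (p : EReal × EReal) : vf (add2 p) ≤ vf p.1 * vf p.2 := by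
  obtain ⟨a, b⟩ := p
  have hz : ∀ a, vf a ≠ 0 := fun a => (zero_lt_one.trans_le (one_le_vf a)).ne'
  simp only [add2]
  induction a with
  | bot => simp [vf_bot, ENNReal.top_mul (hz _)]
  | top =>
    induction b with
    | bot => simp [vf_bot, vf_top]
    | top => simp [vf_top]
    | coe b => simp [vf_top, one_le_vf]
  | coe a =>
    induction b with
    | bot => simp [vf_bot, ENNReal.mul_top (hz _)]
    | top => simp [vf_top, one_le_vf]
    | coe b =>
      rw [← EReal.coe_add, vf_coe, vf_coe, vf_coe, ← ENNReal.ofReal_mul (by positivity)]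
      apply ENNReal.ofReal_le_ofReal
      rw [neg_add, Real.exp_add]
      nlinarith [Real.exp_pos (-a), Real.exp_pos (-b)]

lemma vf_chk (p : EReal × EReal) : vf (chk p) ≤ vf p.1 * vf p.2 := by
  obtain ⟨a, b⟩ := p
  have hz : ∀ a, vf a ≠ 0 := fun a => (zero_lt_one.trans_le (one_le_vf a)).ne'
  induction a with
  | bot => simp [vf_bot, ENNReal.top_mul (hz _)]
  | top => simp [chk_top, vf_top]
  | coe a =>
    induction b with
    | bot => simp [vf_bot, ENNReal.mul_top (hz _)]
    | top => rw [chk_comm, chk_top]; simp [vf_top]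
    | coe b =>
      obtain ⟨r, hr, hr2⟩ := chk_coe a b
      rw [hr]
      simp only
      rw [vf_coe, vf_coe, vf_coe, ← ENNReal.ofReal_mul (by positivity)]
      apply ENNReal.ofReal_le_ofReal
      rw [hr2]
      apply div_le_self (by positivity)
      nlinarith [Real.exp_pos (-a), Real.exp_pos (-b), mul_pos (Real.exp_pos (-a)) (Real.exp_pos (-b))]

lemma entFn_top : entFn ⊤ = 0 := by simp [entFn]
lemma entFn_coe (a : ℝ) : entFn (a : EReal) = Real.logb 2 (1 + Real.exp (-a)) := by simp [entFn]

/-- Pointwise duality rule. -/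
lemma ent_dual (a b : EReal) (ha : a ≠ ⊥) (hb : b ≠ ⊥) :
    entFn (add2 (a, b)) + entFn (chk (a, b)) = entFn a + entFn b := by
  simp only [add2]
  induction a with
  | bot => simp at ha
  | top => rw [chk_top, EReal.top_add_of_ne_bot hb]
  | coe a =>
    induction b with
    | bot => simp at hb
    | top => rw [chk_comm, chk_top, EReal.add_top_of_ne_bot ha, add_comm]
    | coe b =>
      obtain ⟨r, hr, hr2⟩ := chk_coe a b
      rw [hr, ← EReal.coe_add, entFn_coe, entFn_coe, entFn_coe, entFn_coe, hr2, neg_add,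
        Real.exp_add]
      have := Real.exp_pos (-a)
      have := Real.exp_pos (-b)
      rw [← Real.logb_mul (by positivity) (by positivity),
        ← Real.logb_mul (by positivity) (by positivity)]
      congr 1
      field_simp

lemma ent_le (a : EReal) : ENNReal.ofReal ‖entFn a‖ ≤ 2 * vf a := by
  induction a with
  | bot => simp [vf_bot]
  | top => simp [entFn_top]
  | coe a =>
    rw [entFn_coe, vf_coe]
    have h := Real.exp_pos (-a)
    have h0 : 0 ≤ Real.logb 2 (1 + Real.exp (-a)) :=
      Real.logb_nonneg (by norm_num) (by linarith)
    rw [Real.norm_of_nonneg h0, show (2 : ENNReal) = ENNReal.ofReal 2 by simp,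
      ← ENNReal.ofReal_mul (by norm_num)]
    apply ENNReal.ofReal_le_ofReal
    rw [Real.logb, div_le_iff₀ (Real.log_pos (by norm_num))]
    have h1 := Real.log_le_sub_one_of_pos (show 0 < 1 + Real.exp (-a) by linarith)
    have h2 := Real.log_two_gt_d9
    nlinarith

/-! ### Bilinear operations on signed measures -/

/-- Push-forward of the product measure. -/
def mOp (φ : EReal × EReal → EReal) (μ ν : Measure EReal) : Measure EReal := (μ.prod ν).map φ

instance (φ : EReal × EReal → EReal) (μ ν : Measure EReal) [IsFiniteMeasure μ]
    [IsFiniteMeasure ν] : IsFiniteMeasure (mOp φ μ ν) := by unfold mOp; infer_instance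

/-- Its bilinear extension. -/
def sOp (φ : EReal × EReal → EReal) (x y : SM) : SM :=
  (mOp φ (jp x) (jp y)).toSignedMeasure - (mOp φ (jp x) (jn y)).toSignedMeasure
    - (mOp φ (jn x) (jp y)).toSignedMeasure + (mOp φ (jn x) (jn y)).toSignedMeasure

lemma sConv_eq (x y : SM) : sConv x y = sOp add2 x y := rfl
lemma sCheck_eq (x y : SM) : sCheck x y = sOp chk x y := rfl

lemma jp_sub_jn (x : SM) : (jp x).toSignedMeasure - (jn x).toSignedMeasure = x :=
  x.toSignedMeasure_toJordanDecomposition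

lemma cross {a b c d : Measure EReal} [IsFiniteMeasure a] [IsFiniteMeasure b]
    [IsFiniteMeasure c] [IsFiniteMeasure d]
    (h : a.toSignedMeasure - b.toSignedMeasure = c.toSignedMeasure - d.toSignedMeasure) :
    a + d = c + b := by
  rw [← Measure.toSignedMeasure_eq_toSignedMeasure_iff, Measure.toSignedMeasure_add,
    Measure.toSignedMeasure_add]
  exact sub_eq_sub_iff_add_eq_add.1 h

lemma mOp_add_left {φ : EReal × EReal → EReal} (hφ : Measurable φ) (a b c : Measure EReal)
    [IsFiniteMeasure a] [IsFiniteMeasure b] [IsFiniteMeasure c] :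
    mOp φ (a + b) c = mOp φ a c + mOp φ b c := by
  rw [mOp, Measure.add_prod, Measure.map_add _ _ hφ]; rfl

lemma mOp_add_right {φ : EReal × EReal → EReal} (hφ : Measurable φ) (a b c : Measure EReal)
    [IsFiniteMeasure a] [IsFiniteMeasure b] [IsFiniteMeasure c] :
    mOp φ c (a + b) = mOp φ c a + mOp φ c b := by
  rw [mOp, Measure.prod_add, Measure.map_add _ _ hφ]; rfl

lemma tsm_congr {a b : Measure EReal} [IsFiniteMeasure a] [IsFiniteMeasure b] (h : a = b) :
    a.toSignedMeasure = b.toSignedMeasure := by subst h; rfl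

lemma cross_left {φ : EReal × EReal → EReal} (hφ : Measurable φ) {a b c d e : Measure EReal}
    [IsFiniteMeasure a] [IsFiniteMeasure b]
    [IsFiniteMeasure c] [IsFiniteMeasure d] [IsFiniteMeasure e]
    (h : a.toSignedMeasure - b.toSignedMeasure = c.toSignedMeasure - d.toSignedMeasure) :
    (mOp φ a e).toSignedMeasure - (mOp φ b e).toSignedMeasure =
      (mOp φ c e).toSignedMeasure - (mOp φ d e).toSignedMeasure := by
  have h1 := cross h
  rw [sub_eq_sub_iff_add_eq_add, ← Measure.toSignedMeasure_add, ← Measure.toSignedMeasure_add]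
  apply tsm_congr
  rw [← mOp_add_left hφ, ← mOp_add_left hφ, h1]

lemma cross_right {φ : EReal × EReal → EReal} (hφ : Measurable φ) {a b c d e : Measure EReal}
    [IsFiniteMeasure a] [IsFiniteMeasure b]
    [IsFiniteMeasure c] [IsFiniteMeasure d] [IsFiniteMeasure e]
    (h : a.toSignedMeasure - b.toSignedMeasure = c.toSignedMeasure - d.toSignedMeasure) :
    (mOp φ e a).toSignedMeasure - (mOp φ e b).toSignedMeasure =
      (mOp φ e c).toSignedMeasure - (mOp φ e d).toSignedMeasure := by
  have h1 := cross h
  rw [sub_eq_sub_iff_add_eq_add, ← Measure.toSignedMeasure_add, ← Measure.toSignedMeasure_add]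
  apply tsm_congr
  rw [← mOp_add_right hφ, ← mOp_add_right hφ, h1]

/-- `sOp` computed from any representation. -/
lemma sOp_repr {φ : EReal × EReal → EReal} (hφ : Measurable φ) (a b c d : Measure EReal)
    [IsFiniteMeasure a] [IsFiniteMeasure b] [IsFiniteMeasure c] [IsFiniteMeasure d] :
    sOp φ (a.toSignedMeasure - b.toSignedMeasure) (c.toSignedMeasure - d.toSignedMeasure) =
    (mOp φ a c).toSignedMeasure - (mOp φ a d).toSignedMeasure
    - (mOp φ b c).toSignedMeasure + (mOp φ b d).toSignedMeasure := by
  set x := a.toSignedMeasure - b.toSignedMeasure with hx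
  set y := c.toSignedMeasure - d.toSignedMeasure with hy
  have h1 := fun (e : Measure EReal) (_ : IsFiniteMeasure e) =>
    cross_left hφ (e := e) ((jp_sub_jn x).trans hx)
  have h2 := fun (e : Measure EReal) (_ : IsFiniteMeasure e) =>
    cross_right hφ (e := e) ((jp_sub_jn y).trans hy)
  have e1 := h1 (jp y) inferInstance
  have e2 := h1 (jn y) inferInstance
  have e3 := h2 a inferInstance
  have e4 := h2 b inferInstance
  rw [sOp]
  linear_combination (norm := module) e1 - e2 + e3 - e4

lemma sOp_add_left {φ : EReal × EReal → EReal} (hφ : Measurable φ) (x y z : SM) :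
    sOp φ (x + y) z = sOp φ x z + sOp φ y z := by
  have h : x + y = (jp x + jp y).toSignedMeasure - (jn x + jn y).toSignedMeasure := by
    rw [Measure.toSignedMeasure_add, Measure.toSignedMeasure_add]
    nth_rewrite 1 [← jp_sub_jn x, ← jp_sub_jn y]
    abel
  rw [h]
  nth_rewrite 1 [← jp_sub_jn z]
  rw [sOp_repr hφ, sOp, sOp]
  have e := fun (a b c : Measure EReal) [IsFiniteMeasure a] [IsFiniteMeasure b]
    [IsFiniteMeasure c] => (tsm_congr (mOp_add_left hφ a b c)).trans
      (Measure.toSignedMeasure_add _ _)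
  rw [e, e, e, e]
  abel

lemma sOp_comm {φ : EReal × EReal → EReal} (hφ : Measurable φ) 
    (hc : ∀ a b, φ (a, b) = φ (b, a)) (x y : SM) : sOp φ x y = sOp φ y x := by
  have h : ∀ (a b : Measure EReal) [IsFiniteMeasure a] [IsFiniteMeasure b],
      (mOp φ a b).toSignedMeasure = (mOp φ b a).toSignedMeasure := by
    intro a b _ _
    apply tsm_congr
    rw [mOp, mOp, ← Measure.prod_swap, Measure.map_map hφ measurable_swap]
    congr 1
    funext p
    exact hc _ _
  rw [sOp, sOp, h (jp x) (jp y), h (jp x) (jn y), h (jn x) (jp y), h (jn x) (jn y)]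
  abel

lemma tsm_smul (r : NNReal) (a : Measure EReal) [IsFiniteMeasure a] :
    (r • a).toSignedMeasure = (r : ℝ) • a.toSignedMeasure := by
  rw [Measure.toSignedMeasure_smul]; rfl

lemma sOp_smul_left {φ : EReal × EReal → EReal} (hφ : Measurable φ) (r : ℝ) (x z : SM) :
    sOp φ (r • x) z = r • sOp φ x z := by
  let f : SM →+ SM := AddMonoidHom.mk' (fun x => sOp φ x z) (fun x y => sOp_add_left hφ x y z)
  have key : ∀ (r : NNReal) (x : SM), f ((r : ℝ) • x) = (r : ℝ) • f x := by
    intro r x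
    have h : (r : ℝ) • x = (r • jp x).toSignedMeasure - (r • jn x).toSignedMeasure := by
      rw [tsm_smul, tsm_smul]
      conv_lhs => rw [← jp_sub_jn x]
      exact smul_sub _ _ _
    change sOp φ ((r : ℝ) • x) z = (r : ℝ) • sOp φ x z
    rw [h]
    nth_rewrite 1 [← jp_sub_jn z]
    rw [sOp_repr hφ, sOp]
    have e : ∀ (a b : Measure EReal) [IsFiniteMeasure a] [IsFiniteMeasure b],
      (mOp φ (r • a) b).toSignedMeasure = (r : ℝ) • (mOp φ a b).toSignedMeasure := by
      intro a b _ _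
      rw [← tsm_smul]
      apply tsm_congr
      rw [mOp, mOp, Measure.prod_smul_left, Measure.map_smul]
    rw [e, e, e, e]
    simp only [smul_add, smul_sub]
  change f (r • x) = r • f x
  rcases le_total 0 r with h | h
  · exact key ⟨r, h⟩ x
  · have h1 : f ((-r) • x) = (-r) • f x := key ⟨-r, by linarith⟩ x
    have h2 : ∀ w : SM, (-r) • w = -(r • w) := fun w => neg_smul r w
    rw [h2, h2, map_neg] at h1
    exact neg_injective h1

/-- `sOp` as a bilinear map. -/
def bOp (φ : EReal × EReal → EReal) (hφ : Measurable φ) (hc : ∀ a b, φ (a, b) = φ (b, a)) :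
    SM →ₗ[ℝ] SM →ₗ[ℝ] SM :=
  LinearMap.mk₂ ℝ (sOp φ) (fun x y z => sOp_add_left hφ x y z)
    (fun r x z => sOp_smul_left hφ r x z)
    (fun x y z => by rw [sOp_comm hφ hc x, sOp_add_left hφ, sOp_comm hφ hc y, sOp_comm hφ hc z])
    (fun r x z => by rw [sOp_comm hφ hc x, sOp_smul_left hφ, sOp_comm hφ hc z])

lemma sOp_pos {φ : EReal × EReal → EReal} (hφ : Measurable φ) (a b : Measure EReal)
    [IsFiniteMeasure a] [IsFiniteMeasure b] :
    sOp φ a.toSignedMeasure b.toSignedMeasure = (mOp φ a b).toSignedMeasure := by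
  have h := sOp_repr hφ a 0 b 0
  have e1 : (mOp φ a 0).toSignedMeasure = 0 := by
    rw [← Measure.toSignedMeasure_zero]; apply tsm_congr; simp [mOp]
  have e2 : (mOp φ 0 b).toSignedMeasure = 0 := by
    rw [← Measure.toSignedMeasure_zero]; apply tsm_congr; simp [mOp]
  have e3 : (mOp φ 0 0).toSignedMeasure = 0 := by
    rw [← Measure.toSignedMeasure_zero]; apply tsm_congr; simp [mOp]
  rw [e1, e2, e3, Measure.toSignedMeasure_zero] at h
  simpa using h

lemma bOp_assoc {φ : EReal × EReal → EReal} (hφ : Measurable φ)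
    (hc : ∀ a b, φ (a, b) = φ (b, a)) (ha : ∀ a b c, φ (φ (a, b), c) = φ (a, φ (b, c)))
    (x y z : SM) :
    bOp φ hφ hc (bOp φ hφ hc x y) z = bOp φ hφ hc x (bOp φ hφ hc y z) := by
  have key : ∀ (a b c : Measure EReal) (_ : IsFiniteMeasure a) (_ : IsFiniteMeasure b)
      (_ : IsFiniteMeasure c),
      bOp φ hφ hc (bOp φ hφ hc a.toSignedMeasure b.toSignedMeasure) c.toSignedMeasure =
      bOp φ hφ hc a.toSignedMeasure (bOp φ hφ hc b.toSignedMeasure c.toSignedMeasure) := by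
    intro a b c _ _ _
    change sOp φ (sOp φ _ _) _ = sOp φ _ (sOp φ _ _)
    rw [sOp_pos hφ, sOp_pos hφ, sOp_pos hφ, sOp_pos hφ]
    apply tsm_congr
    have e1 : (mOp φ a b).prod c = ((a.prod b).prod c).map (Prod.map φ id) := by
      rw [← Measure.map_prod_map _ _ hφ measurable_id, Measure.map_id]; rfl
    have e2 : a.prod (mOp φ b c) = (a.prod (b.prod c)).map (Prod.map id φ) := by
      rw [← Measure.map_prod_map _ _ measurable_id hφ, Measure.map_id]; rfl
    rw [mOp, e1, mOp, e2, ← Measure.prodAssoc_prod, Measure.map_map hφ (by fun_prop),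
      Measure.map_map hφ (by fun_prop), Measure.map_map (by fun_prop) (by fun_prop)]
    congr 1
    funext p
    exact ha _ _ _
  rw [← jp_sub_jn x, ← jp_sub_jn y, ← jp_sub_jn z]
  simp only [map_sub, LinearMap.sub_apply, key]

lemma sOp_univ {φ : EReal × EReal → EReal} (hφ : Measurable φ) (x y : SM) :
    sOp φ x y Set.univ = x Set.univ * y Set.univ := by
  have e : ∀ (a b : Measure EReal) [IsFiniteMeasure a] [IsFiniteMeasure b],
      (mOp φ a b).toSignedMeasure Set.univ = a.real Set.univ * b.real Set.univ := by
    intro a b _ _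
    rw [Measure.toSignedMeasure_apply_measurable MeasurableSet.univ, mOp, 
      map_measureReal_apply hφ MeasurableSet.univ, Set.preimage_univ, ← Set.univ_prod_univ,
      measureReal_prod_prod]
  have e2 : ∀ x : SM, x Set.univ = (jp x).real Set.univ - (jn x).real Set.univ := by
    intro x
    nth_rewrite 1 [← jp_sub_jn x]
    simp [Measure.toSignedMeasure_apply_measurable MeasurableSet.univ]
  rw [e2 x, e2 y, sOp]
  simp only [add_apply, sub_apply, e]
  ring

/-! ### The entropy functional on good measures -/

/-- Measures integrating `1 + e^{-α}`. -/
def GM (μ : Measure EReal) : Prop := ∫⁻ α, vf α ∂μ < ⊤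

/-- Good signed measures. -/
def Good (x : SM) : Prop := GM (jp x) ∧ GM (jn x)

lemma GM.mono {μ ν : Measure EReal} (h : GM ν) (hle : μ ≤ ν) : GM μ :=
  (lintegral_mono' hle le_rfl).trans_lt h

lemma GM.add {μ ν : Measure EReal} (h : GM μ) (h' : GM ν) : GM (μ + ν) := by
  rw [GM, lintegral_add_measure]
  exact ENNReal.add_lt_top.2 ⟨h, h'⟩

lemma GM.int {μ : Measure EReal} (h : GM μ) : Integrable entFn μ := by
  refine ⟨entFn_meas.aestronglyMeasurable, ?_⟩
  rw [hasFiniteIntegral_iff_norm]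
  refine (lintegral_mono ent_le).trans_lt ?_
  rw [lintegral_const_mul _ vf_meas]
  exact ENNReal.mul_lt_top (by simp) h

lemma GM.ae {μ : Measure EReal} (h : GM μ) : ∀ᵐ a ∂μ, a ≠ ⊥ := by
  filter_upwards [ae_lt_top vf_meas h.ne] with a ha hb
  rw [hb, vf_bot] at ha
  exact lt_irrefl _ ha

lemma GM.op {φ : EReal × EReal → EReal} (hφ : Measurable φ)
    (hv : ∀ p, vf (φ p) ≤ vf p.1 * vf p.2) {μ ν : Measure EReal} [IsFiniteMeasure μ]
    [IsFiniteMeasure ν] (h : GM μ) (h' : GM ν) : GM (mOp φ μ ν) := by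
  rw [GM, mOp, lintegral_map vf_meas hφ]
  refine (lintegral_mono hv).trans_lt ?_
  rw [lintegral_prod_mul vf_meas.aemeasurable vf_meas.aemeasurable]
  exact ENNReal.mul_lt_top h h'

lemma jp_le {a b : Measure EReal} [IsFiniteMeasure a] [IsFiniteMeasure b] :
    jp (a.toSignedMeasure - b.toSignedMeasure) ≤ a ∧
    jn (a.toSignedMeasure - b.toSignedMeasure) ≤ b := by
  set x := a.toSignedMeasure - b.toSignedMeasure with hx
  have h := cross ((jp_sub_jn x).trans hx)
  obtain ⟨s, hs, h1, h2⟩ := x.toJordanDecomposition.mutuallySingular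
  change jp x s = 0 at h1
  change jn x sᶜ = 0 at h2
  constructor
  · refine Measure.le_iff.2 fun E hE => ?_
    have h3 : jp x E ≤ jp x s + jp x (E ∩ sᶜ) := by
      refine (measure_mono ?_).trans (measure_union_le _ _)
      intro z hz
      by_cases hzs : z ∈ s
      · exact Or.inl hzs
      · exact Or.inr ⟨hz, hzs⟩
    have h4 := congrArg (fun m : Measure EReal => m (E ∩ sᶜ)) h
    simp only [Measure.add_apply] at h4
    have h5 : jn x (E ∩ sᶜ) = 0 := measure_mono_null Set.inter_subset_right h2
    rw [h1, zero_add] at h3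
    rw [h5, add_zero] at h4
    exact h3.trans ((le_add_right le_rfl).trans (h4.le.trans (measure_mono Set.inter_subset_left)))
  · refine Measure.le_iff.2 fun E hE => ?_
    have h3 : jn x E ≤ jn x sᶜ + jn x (E ∩ s) := by
      refine (measure_mono ?_).trans (measure_union_le _ _)
      intro z hz
      by_cases hzs : z ∈ s
      · exact Or.inr ⟨hz, hzs⟩
      · exact Or.inl hzs
    have h4 := congrArg (fun m : Measure EReal => m (E ∩ s)) h
    simp only [Measure.add_apply] at h4
    have h5 : jp x (E ∩ s) = 0 := measure_mono_null Set.inter_subset_right h1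
    rw [h2, zero_add] at h3
    rw [h5, zero_add] at h4
    exact h3.trans ((le_add_left le_rfl).trans (h4.ge.trans (measure_mono Set.inter_subset_left)))

lemma good_repr {a b : Measure EReal} [IsFiniteMeasure a] [IsFiniteMeasure b]
    (ha : GM a) (hb : GM b) : Good (a.toSignedMeasure - b.toSignedMeasure) :=
  ⟨ha.mono jp_le.1, hb.mono jp_le.2⟩

lemma good_pos {a : Measure EReal} [IsFiniteMeasure a] (ha : GM a) : Good a.toSignedMeasure := by
  have := good_repr (b := 0) ha (by simp [GM])
  rwa [Measure.toSignedMeasure_zero, sub_zero] at this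

lemma H_repr {a b : Measure EReal} [IsFiniteMeasure a] [IsFiniteMeasure b]
    (ha : GM a) (hb : GM b) :
    H (a.toSignedMeasure - b.toSignedMeasure) = ∫ α, entFn α ∂a - ∫ α, entFn α ∂b := by
  have hg := good_repr ha hb
  set x := a.toSignedMeasure - b.toSignedMeasure with hx
  have h := cross ((jp_sub_jn x).trans hx)
  have h2 := congrArg (fun m : Measure EReal => ∫ α, entFn α ∂m) h
  rw [integral_add_measure hg.1.int hb.int, integral_add_measure ha.int hg.2.int] at h2
  rw [H, sInt]
  linarith

lemma add_repr (x y : SM) :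
    x + y = (jp x + jp y).toSignedMeasure - (jn x + jn y).toSignedMeasure := by
  rw [Measure.toSignedMeasure_add, Measure.toSignedMeasure_add]
  nth_rewrite 1 [← jp_sub_jn x, ← jp_sub_jn y]
  abel

lemma Good.add {x y : SM} (hx : Good x) (hy : Good y) : Good (x + y) := by
  rw [add_repr]; exact good_repr (hx.1.add hy.1) (hx.2.add hy.2)

lemma H_add {x y : SM} (hx : Good x) (hy : Good y) : H (x + y) = H x + H y := by
  rw [add_repr, H_repr (hx.1.add hy.1) (hx.2.add hy.2),
    integral_add_measure hx.1.int hy.1.int, integral_add_measure hx.2.int hy.2.int, H, H,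
    sInt, sInt]
  ring

lemma neg_repr (x : SM) : -x = (jn x).toSignedMeasure - (jp x).toSignedMeasure := by
  nth_rewrite 1 [← jp_sub_jn x]
  abel

lemma Good.neg {x : SM} (hx : Good x) : Good (-x) := by
  rw [neg_repr]; exact good_repr hx.2 hx.1

lemma H_neg {x : SM} (hx : Good x) : H (-x) = -H x := by
  rw [neg_repr, H_repr hx.2 hx.1, H, sInt]; ring

lemma smul_repr (r : NNReal) (x : SM) :
    (r : ℝ) • x = (r • jp x).toSignedMeasure - (r • jn x).toSignedMeasure := by
  rw [tsm_smul, tsm_smul]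
  conv_lhs => rw [← jp_sub_jn x]
  exact smul_sub _ _ _

lemma GM.smul (r : NNReal) {a : Measure EReal} (h : GM a) : GM (r • a) := by
  rw [GM, lintegral_smul_measure, ENNReal.smul_def, smul_eq_mul]
  exact ENNReal.mul_lt_top (by simp) h

lemma smul_aux (r : NNReal) {x : SM} (hx : Good x) :
    Good ((r : ℝ) • x) ∧ H ((r : ℝ) • x) = r * H x := by
  rw [smul_repr, H_repr (hx.1.smul r) (hx.2.smul r), integral_smul_nnreal_measure,
    integral_smul_nnreal_measure, H, sInt]
  refine ⟨good_repr (hx.1.smul r) (hx.2.smul r), ?_⟩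
  simp only [NNReal.smul_def, smul_eq_mul]
  ring

lemma smul_aux' (r : ℝ) {x : SM} (hx : Good x) : Good (r • x) ∧ H (r • x) = r * H x := by
  rcases le_total 0 r with h | h
  · exact smul_aux ⟨r, h⟩ hx
  · have h1 : Good ((-r) • x) ∧ H ((-r) • x) = (-r) * H x := smul_aux ⟨-r, by linarith⟩ hx
    have h2 : r • x = -((-r) • x) := by
      have := neg_smul (-r) x
      rwa [neg_neg] at this
    rw [h2, H_neg h1.1, h1.2]
    exact ⟨h1.1.neg, by ring⟩

lemma Good.smul (r : ℝ) {x : SM} (hx : Good x) : Good (r • x) := (smul_aux' r hx).1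
lemma H_smul (r : ℝ) {x : SM} (hx : Good x) : H (r • x) = r * H x := (smul_aux' r hx).2

lemma Good.zero : Good (0 : SM) := by
  have := good_pos (a := 0) (by simp [GM])
  rwa [Measure.toSignedMeasure_zero] at this

lemma Good.op {φ : EReal × EReal → EReal} (hφ : Measurable φ)
    (hv : ∀ p, vf (φ p) ≤ vf p.1 * vf p.2) {x y : SM} (hx : Good x) (hy : Good y) :
    Good (sOp φ x y) := by
  rw [sOp]
  have h11 := good_pos (hx.1.op hφ hv hy.1)
  have h12 := good_pos (hx.1.op hφ hv hy.2)
  have h21 := good_pos (hx.2.op hφ hv hy.1)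
  have h22 := good_pos (hx.2.op hφ hv hy.2)
  rw [sub_eq_add_neg, sub_eq_add_neg]
  exact ((h11.add h12.neg).add h21.neg).add h22

lemma good_d0 : Good d0 := by
  apply good_pos
  rw [GM, lintegral_dirac, ← EReal.coe_zero, vf_coe]
  simp

lemma good_dTop : Good dTop := by
  apply good_pos
  rw [GM, lintegral_dirac, vf_top]
  simp

lemma H_op {φ : EReal × EReal → EReal} (hφ : Measurable φ)
    (hv : ∀ p, vf (φ p) ≤ vf p.1 * vf p.2) {x y : SM} (hx : Good x) (hy : Good y) :
    H (sOp φ x y) = ∫ p, entFn (φ p) ∂((jp x).prod (jp y)) - ∫ p, entFn (φ p) ∂((jp x).prod (jn y))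
      - ∫ p, entFn (φ p) ∂((jn x).prod (jp y)) + ∫ p, entFn (φ p) ∂((jn x).prod (jn y)) := by
  have h11 := hx.1.op hφ hv hy.1
  have h12 := hx.1.op hφ hv hy.2
  have h21 := hx.2.op hφ hv hy.1
  have h22 := hx.2.op hφ hv hy.2
  have e : sOp φ x y = (mOp φ (jp x) (jp y) + mOp φ (jn x) (jn y)).toSignedMeasure -
      (mOp φ (jp x) (jn y) + mOp φ (jn x) (jp y)).toSignedMeasure := by
    rw [sOp, Measure.toSignedMeasure_add, Measure.toSignedMeasure_add]
    abel
  rw [e, H_repr (h11.add h22) (h12.add h21), integral_add_measure h11.int h22.int,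
    integral_add_measure h12.int h21.int]
  simp only [mOp]
  rw [integral_map hφ.aemeasurable entFn_meas.aestronglyMeasurable,
    integral_map hφ.aemeasurable entFn_meas.aestronglyMeasurable,
    integral_map hφ.aemeasurable entFn_meas.aestronglyMeasurable,
    integral_map hφ.aemeasurable entFn_meas.aestronglyMeasurable]
  ring

lemma dual_pos {a b : Measure EReal} [IsFiniteMeasure a] [IsFiniteMeasure b]
    (ha : GM a) (hb : GM b) :
    ∫ p, entFn (add2 p) ∂(a.prod b) + ∫ p, entFn (chk p) ∂(a.prod b) =
      b.real Set.univ * ∫ α, entFn α ∂a + a.real Set.univ * ∫ α, entFn α ∂b := by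
  have i1 : Integrable (fun p => entFn (add2 p)) (a.prod b) :=
    (integrable_map_measure entFn_meas.aestronglyMeasurable add2_meas.aemeasurable).1
      (GM.op add2_meas vf_add ha hb).int
  have i2 : Integrable (fun p => entFn (chk p)) (a.prod b) :=
    (integrable_map_measure entFn_meas.aestronglyMeasurable chk_meas.aemeasurable).1
      (GM.op chk_meas vf_chk ha hb).int
  rw [← integral_add i1 i2, ← smul_eq_mul, ← smul_eq_mul (a.real _), ← integral_fun_fst,
    ← integral_fun_snd, ← integral_add (ha.int.comp_fst b) (hb.int.comp_snd a)]
  apply integral_congr_ae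
  filter_upwards [Measure.quasiMeasurePreserving_fst.ae ha.ae,
    Measure.quasiMeasurePreserving_snd.ae hb.ae] with p h1 h2
  exact ent_dual p.1 p.2 h1 h2

lemma univ_eq (x : SM) : x Set.univ = (jp x).real Set.univ - (jn x).real Set.univ := by
  nth_rewrite 1 [← jp_sub_jn x]
  simp [Measure.toSignedMeasure_apply_measurable MeasurableSet.univ]

/-- The duality rule. -/
lemma dual {x y : SM} (hx : Good x) (hy : Good y) :
    H (sOp add2 x y) + H (sOp chk x y) = y Set.univ * H x + x Set.univ * H y := by
  rw [H_op add2_meas vf_add hx hy, H_op chk_meas vf_chk hx hy, univ_eq x, univ_eq y, H, H,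
    sInt, sInt]
  linarith [dual_pos hx.1 hy.1, dual_pos hx.1 hy.2, dual_pos hx.2 hy.1, dual_pos hx.2 hy.2]

lemma symm_GM {μ : Measure EReal} [IsFiniteMeasure μ] (h : IsSymmMeasure μ) : GM μ := by
  have hm : Measurable (fun a : EReal => -a) := measurable_neg
  have e : (μ.withDensity wt).map (fun a : EReal => -a) = μ.withDensity wt := by
    ext E hE
    rw [Measure.map_apply hm hE, withDensity_apply _ (hm hE), withDensity_apply _ hE, h E hE]
  have e2 : ∫⁻ α, wt α * wt α ∂μ = ∫⁻ α, wt α * wt (-α) ∂μ := by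
    have h1 := lintegral_withDensity_eq_lintegral_mul μ wt_meas wt_meas
    have h2 := lintegral_withDensity_eq_lintegral_mul μ wt_meas (wt_meas.comp hm)
    simp only [Pi.mul_apply, Function.comp_apply] at h1 h2
    rw [← h1, ← h2, ← lintegral_map wt_meas hm, e]
  have e3 : ∀ α, wt α * wt (-α) ≤ 1 := by
    intro α
    induction α with
    | bot => simp [wt]
    | top => simp [wt]
    | coe a =>
      rw [← EReal.coe_neg, wt_coe, wt_coe, ← ENNReal.ofReal_mul (by positivity), ← Real.exp_add]
      ring_nf
      simp
  rw [GM]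
  simp only [vf]
  rw [lintegral_add_left measurable_const, e2]
  refine ENNReal.add_lt_top.2 ⟨by simp, (lintegral_mono e3).trans_lt (by simp)⟩

lemma MemX.good {x : SM} (h : MemX x) : Good x := ⟨symm_GM h.2.1, symm_GM h.2.2⟩

lemma MemX.univ {x : SM} (h : MemX x) : x Set.univ = 1 := by
  obtain ⟨⟨μ, hμ, rfl⟩, -⟩ := h
  rw [Measure.toSignedMeasure_apply_measurable MeasurableSet.univ]
  simp

/-! ### Polynomial curves of signed measures and their derivatives -/

/-- The properties of the two node maps that are used. -/
structure OkMap (φ : EReal × EReal → EReal) : Prop where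
  meas : Measurable φ
  comm : ∀ a b, φ (a, b) = φ (b, a)
  assoc : ∀ a b c, φ (φ (a, b), c) = φ (a, φ (b, c))
  sub : ∀ p, vf (φ p) ≤ vf p.1 * vf p.2

lemma ok_add : OkMap add2 :=
  ⟨add2_meas, fun a b => add_comm a b, fun a b c => add_assoc a b c, vf_add⟩

lemma ok_chk : OkMap chk := ⟨chk_meas, chk_comm, chk_assoc, vf_chk⟩

/-- The bilinear operation of an `OkMap`. -/
def OkMap.b {φ : EReal × EReal → EReal} (h : OkMap φ) : SM →ₗ[ℝ] SM →ₗ[ℝ] SM :=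
  bOp φ h.meas h.comm

lemma OkMap.b_eq {φ : EReal × EReal → EReal} (h : OkMap φ) (x y : SM) :
    h.b x y = sOp φ x y := rfl

lemma OkMap.b_comm {φ : EReal × EReal → EReal} (h : OkMap φ) (x y : SM) :
    h.b x y = h.b y x := sOp_comm h.meas h.comm x y

lemma OkMap.b_assoc {φ : EReal × EReal → EReal} (h : OkMap φ) (x y z : SM) :
    h.b (h.b x y) z = h.b x (h.b y z) := bOp_assoc h.meas h.comm h.assoc x y z

lemma OkMap.good {φ : EReal × EReal → EReal} (h : OkMap φ) {x y : SM} (hx : Good x)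
    (hy : Good y) : Good (h.b x y) := hx.op h.meas h.sub hy

/-- Polynomial curves in the space of good signed measures. -/
inductive Pc : (ℝ → SM) → Prop
  | const (a : SM) : Good a → Pc (fun _ => a)
  | add (u v : ℝ → SM) : Pc u → Pc v → Pc (fun t => u t + v t)
  | smul (u : ℝ → SM) : Pc u → Pc (fun t => t • u t)

lemma Pc.good {u : ℝ → SM} (h : Pc u) (t : ℝ) : Good (u t) := by
  induction h with
  | const a ha => exact ha
  | add u v _ _ hu hv => exact hu.add hv
  | smul u _ hu => exact hu.smul t

lemma Pc.cont {u : ℝ → SM} (h : Pc u) : Continuous (fun t => H (u t)) := by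
  induction h with
  | const a ha => exact continuous_const
  | add u v h1 h2 hu hv =>
    have : (fun t => H (u t + v t)) = fun t => H (u t) + H (v t) := by
      funext t; exact H_add (h1.good t) (h2.good t)
    rw [this]; exact hu.add hv
  | smul u h1 hu =>
    have : (fun t => H (t • u t)) = fun t => t * H (u t) := by
      funext t; exact H_smul t (h1.good t)
    rw [this]; exact continuous_id.mul hu

lemma Pc.op {φ : EReal × EReal → EReal} (h : OkMap φ) {u v : ℝ → SM} (hu : Pc u) (hv : Pc v) :
    Pc (fun t => h.b (u t) (v t)) := by
  induction hu with
  | const a ha =>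
    induction hv with
    | const b hb => exact Pc.const _ (h.good ha hb)
    | add u v _ _ hu hv =>
      simp only [map_add]
      exact Pc.add _ _ hu hv
    | smul u _ hu =>
      simp only [map_smul]
      exact Pc.smul _ hu
  | add u w _ _ hu hw =>
    simp only [map_add, LinearMap.add_apply]
    exact Pc.add _ _ hu hw
  | smul u _ hu =>
    simp only [map_smul, LinearMap.smul_apply]
    exact Pc.smul _ hu

lemma Pc.csmul (r : ℝ) {u : ℝ → SM} (hu : Pc u) : Pc (fun t => r • u t) := by
  induction hu with
  | const a ha => exact Pc.const _ (ha.smul r)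
  | add u w _ _ hu hw =>
    simp only [smul_add]
    exact Pc.add _ _ hu hw
  | smul u _ hu =>
    simp only [smul_comm r]
    exact Pc.smul _ hu

/-- `v` is the difference quotient curve of `u` at `0`. -/
structure Dv (u v : ℝ → SM) : Prop where
  pu : Pc u
  pv : Pc v
  eq : ∀ t, u t = u 0 + t • v t

lemma Dv.const {a : SM} (ha : Good a) : Dv (fun _ => a) (fun _ => 0) :=
  ⟨Pc.const a ha, Pc.const _ Good.zero, fun t => by simp⟩

lemma Dv.add {u v u' v' : ℝ → SM} (h : Dv u v) (h' : Dv u' v') :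
    Dv (fun t => u t + u' t) (fun t => v t + v' t) :=
  ⟨Pc.add _ _ h.pu h'.pu, Pc.add _ _ h.pv h'.pv, fun t => by
    rw [h.eq t, h'.eq t]; module⟩

lemma Dv.csmul (r : ℝ) {u v : ℝ → SM} (h : Dv u v) :
    Dv (fun t => r • u t) (fun t => r • v t) :=
  ⟨h.pu.csmul r, h.pv.csmul r, fun t => by rw [h.eq t]; module⟩

lemma Dv.sum (u v : ℕ → ℝ → SM) (N : ℕ) (h : ∀ n, Dv (u n) (v n)) :
    Dv (fun t => ∑ n ∈ Finset.range N, u n t) (fun t => ∑ n ∈ Finset.range N, v n t) := by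
  induction N with
  | zero => simpa using Dv.const Good.zero
  | succ N ih =>
    simp only [Finset.sum_range_succ]
    exact ih.add (h N)

lemma Dv.op {φ : EReal × EReal → EReal} (k : OkMap φ) {u v u' v' : ℝ → SM} (h : Dv u v)
    (h' : Dv u' v') :
    Dv (fun t => k.b (u t) (u' t)) (fun t => k.b (v t) (u' t) + k.b (u 0) (v' t)) := by
  refine ⟨h.pu.op k h'.pu, Pc.add _ _ (h.pv.op k h'.pu)
    ((Pc.const _ (h.pu.good 0)).op k h'.pv), fun t => ?_⟩
  have e1 : k.b (u t) (u' t) = k.b (u 0) (u' t) + t • k.b (v t) (u' t) := by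
    conv_lhs => rw [h.eq t]
    simp only [map_add, map_smul, LinearMap.add_apply, LinearMap.smul_apply]
  have e2 : k.b (u 0) (u' t) = k.b (u 0) (u' 0) + t • k.b (u 0) (v' t) := by
    conv_lhs => rw [h'.eq t]
    simp only [map_add, map_smul]
  rw [e1, e2]
  module

lemma Dv.lim {u v : ℝ → SM} (h : Dv u v) :
    Tendsto (fun t : ℝ => (H (u t) - H (u 0)) / t) (𝓝[≠] (0 : ℝ)) (𝓝 (H (v 0))) := by
  have h1 : Tendsto (fun t : ℝ => H (v t)) (𝓝[≠] (0 : ℝ)) (𝓝 (H (v 0))) :=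
    (h.pv.cont.tendsto 0).mono_left nhdsWithin_le_nhds
  refine h1.congr' ?_
  filter_upwards [self_mem_nhdsWithin] with t ht
  have ht : t ≠ 0 := ht
  rw [h.eq t, H_add (h.pu.good 0) ((h.pv.good t).smul t), H_smul t (h.pv.good t)]
  field_simp
  ring

/-- Powers for a general operation. -/
def gpow (φ : EReal × EReal → EReal) (e x : SM) : ℕ → SM
  | 0 => e
  | n + 1 => sOp φ (gpow φ e x n) x

/-- Polynomials for a general operation. -/
def gpoly (φ : EReal × EReal → EReal) (e : SM) (p : Polynomial ℝ) (x : SM) : SM :=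
  ∑ n ∈ Finset.range (p.natDegree + 1), p.coeff n • gpow φ e x n

lemma convPow_eq (x : SM) (n : ℕ) : convPow x n = gpow add2 d0 x n := by
  induction n with
  | zero => rfl
  | succ n ih => rw [convPow, gpow, ih]; rfl

lemma checkPow_eq (x : SM) (n : ℕ) : checkPow x n = gpow chk dTop x n := by
  induction n with
  | zero => rfl
  | succ n ih => rw [checkPow, gpow, ih]; rfl

lemma polyConv_eq (p : Polynomial ℝ) (x : SM) : polyConv p x = gpoly add2 d0 p x := by
  simp only [polyConv, gpoly, convPow_eq]

lemma polyCheck_eq (p : Polynomial ℝ) (x : SM) : polyCheck p x = gpoly chk dTop p x := by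
  simp only [polyCheck, gpoly, checkPow_eq]

lemma gpoly_range (φ : EReal × EReal → EReal) (e : SM) (p : Polynomial ℝ) (x : SM) (N : ℕ)
    (hN : p.natDegree + 1 ≤ N) :
    gpoly φ e p x = ∑ n ∈ Finset.range N, p.coeff n • gpow φ e x n := by
  refine Finset.sum_subset (Finset.range_mono hN) ?_
  intro n _ hn
  have : p.coeff n = 0 := by
    apply Polynomial.coeff_eq_zero_of_natDegree_lt
    simp only [Finset.mem_range] at hn
    omega
  rw [this]
  exact zero_smul ℝ _

lemma gpoly_C_mul (φ : EReal × EReal → EReal) (e : SM) (p : Polynomial ℝ) (x : SM) (r : ℝ) :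
    gpoly φ e (Polynomial.C r * p) x = r • gpoly φ e p x := by
  rw [gpoly_range φ e (Polynomial.C r * p) x (p.natDegree + 1)
    (Nat.succ_le_succ (Polynomial.natDegree_C_mul_le r p)), gpoly, Finset.smul_sum]
  refine Finset.sum_congr rfl fun n _ => ?_
  rw [Polynomial.coeff_C_mul]
  exact mul_smul _ _ _

lemma Dv.pow {φ : EReal × EReal → EReal} (k : OkMap φ) {e : SM} (he : Good e) {u v : ℝ → SM}
    (h : Dv u v) (n : ℕ) : ∃ w, Dv (fun t => gpow φ e (u t) n) w ∧
      w 0 = (n : ℝ) • k.b (gpow φ e (u 0) (n - 1)) (v 0) := by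
  induction n with
  | zero => exact ⟨_, Dv.const he, by simp⟩
  | succ n ih =>
    obtain ⟨w, hw, hw0⟩ := ih
    refine ⟨_, Dv.op k hw h, ?_⟩
    rw [hw0]
    cases n with
    | zero => simp
    | succ m =>
      have e1 : k.b (k.b (gpow φ e (u 0) m) (v 0)) (u 0) =
          k.b (gpow φ e (u 0) (m + 1)) (v 0) := by
        rw [k.b_assoc, k.b_comm (v 0), ← k.b_assoc]; rfl
      simp only [map_smul, LinearMap.smul_apply, Nat.add_sub_cancel, e1]
      push_cast
      module

lemma Dv.poly {φ : EReal × EReal → EReal} (k : OkMap φ) {e : SM} (he : Good e) {u v : ℝ → SM}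
    (h : Dv u v) (p : Polynomial ℝ) : ∃ w, Dv (fun t => gpoly φ e p (u t)) w ∧
      w 0 = k.b (gpoly φ e (derivative p) (u 0)) (v 0) := by
  choose w hw hw0 using Dv.pow k he h
  have hN : (derivative p).natDegree + 1 ≤ p.natDegree + 1 :=
    Nat.succ_le_succ ((Polynomial.natDegree_derivative_le p).trans (Nat.sub_le _ _))
  have e1 : (fun t => gpoly φ e p (u t)) =
      fun t => ∑ n ∈ Finset.range (p.natDegree + 1 + 1), p.coeff n • gpow φ e (u t) n := by
    funext t; exact gpoly_range _ _ _ _ _ (by omega)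
  rw [e1]
  refine ⟨_, Dv.sum _ _ _ (fun n => (hw n).csmul (p.coeff n)), ?_⟩
  simp only [hw0]
  rw [Finset.sum_range_succ', gpoly_range _ _ _ _ _ hN]
  simp only [map_sum, map_smul, LinearMap.sum_apply, LinearMap.smul_apply,
    Polynomial.coeff_derivative, Nat.add_sub_cancel]
  have : ∀ z : SM, p.coeff 0 • ((0 : ℕ) : ℝ) • z = 0 := by intro z; simp
  rw [this, add_zero]
  refine Finset.sum_congr rfl fun n _ => ?_
  push_cast
  module

/-- Every density-evolution fixed point is a stationary point of the
potential: if `x = c ⊛ λ^⊛(ρ^⊠(x))`, then for every `y ∈ X_d` the directional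
derivative `d_x U(x; c)[y]` exists and equals `0`. -/
theorem fixed_point_is_stationary
    (lam rho L R : Polynomial ℝ)
    (hlam0 : lam.coeff 0 = 0) (hrho0 : rho.coeff 0 = 0)
    (hlamnn : ∀ n, 0 ≤ lam.coeff n) (hrhonn : ∀ n, 0 ≤ rho.coeff n)
    (hlam1 : lam.eval 1 = 1) (hrho1 : rho.eval 1 = 1)
    (hL0 : L.eval 0 = 0) (hL1 : L.eval 1 = 1)
    (hR0 : R.eval 0 = 0) (hR1 : R.eval 1 = 1)
    (hLd : derivative L = Polynomial.C ((derivative L).eval 1) * lam)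
    (hRd : derivative R = Polynomial.C ((derivative R).eval 1) * rho)
    (x c : SM) (hx : MemX x) (hc : MemX c)
    (hfix : x = sConv c (polyConv lam (polyCheck rho x))) :
    ∀ y : SM, MemXd y →
      Tendsto
        (fun δ : ℝ => (potU rho L R (x + δ • y) c - potU rho L R x c) / δ)
        (𝓝[≠] (0 : ℝ)) (𝓝 (0 : ℝ)) := by
  intro y hy
  have gx := hx.good
  have gc := hc.good
  have gy : Good y := by
    obtain ⟨x1, x2, h1, h2, rfl⟩ := hy
    rw [sub_eq_add_neg]
    exact h1.good.add h2.good.neg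
  have my : y Set.univ = 0 := by
    obtain ⟨x1, x2, h1, h2, rfl⟩ := hy
    rw [sub_apply, h1.univ, h2.univ, sub_self]
  have hRne : (derivative R).eval 1 ≠ 0 := by
    intro h0
    rw [h0, Polynomial.C_0, zero_mul] at hRd
    have h1 := Polynomial.natDegree_eq_zero_of_derivative_eq_zero hRd
    rw [Polynomial.eq_C_of_natDegree_eq_zero h1] at hR0 hR1
    simp only [Polynomial.eval_C] at hR0 hR1
    rw [hR0] at hR1
    exact zero_ne_one hR1
  have hu : Dv (fun t : ℝ => x + t • y) (fun _ => y) :=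
    ⟨Pc.add _ _ (Pc.const x gx) (Pc.smul _ (Pc.const y gy)), Pc.const y gy, fun t => by simp⟩
  have hu0 : x + (0 : ℝ) • y = x := by simp
  obtain ⟨wR, dR, dR0⟩ := Dv.poly ok_chk good_dTop hu R
  obtain ⟨wr, dr, dr0⟩ := Dv.poly ok_chk good_dTop hu rho
  have dx := Dv.op ok_chk hu dr
  obtain ⟨wL, dL, dL0⟩ := Dv.poly ok_add good_d0 dr L
  have dc := Dv.op ok_add (Dv.const gc) dL
  have lR := dR.lim
  have lr := dr.lim
  have lx := dx.lim
  have lc := dc.lim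
  simp only [hu0, map_zero, LinearMap.zero_apply, zero_add] at dR0 dr0 dL0 lR lr lx lc
  have gr : Good (gpoly chk dTop rho x) := by
    have := dr.pu.good 0
    simpa only [hu0] using this
  have gr1 : Good (wr 0) := dr.pv.good 0
  have mr1 : wr 0 Set.univ = 0 := by
    rw [dr0, OkMap.b_eq, sOp_univ chk_meas, my, mul_zero]
  have gry := ok_chk.good gr gy
  have hfix' : x = ok_add.b c (gpoly add2 d0 lam (gpoly chk dTop rho x)) := by
    rw [← polyCheck_eq, ← polyConv_eq]; exact hfix
  have gLr : Good (sOp add2 x (wr 0)) := ok_add.good gx gr1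
  have vR : H (wR 0) = (derivative R).eval 1 * H (ok_chk.b (gpoly chk dTop rho x) y) := by
    rw [dR0, hRd, gpoly_C_mul, map_smul, LinearMap.smul_apply, H_smul _ gry,
      ← hRd]
  have vc : H (ok_add.b c (wL 0)) = (derivative L).eval 1 * H (sOp add2 x (wr 0)) := by
    rw [dL0, hLd, gpoly_C_mul, map_smul, LinearMap.smul_apply, map_smul, ← OkMap.b_assoc,
      ← hfix', ← hLd, ok_add.b_eq, H_smul _ gLr]
  have vx : H (ok_chk.b y (gpoly chk dTop rho x) + ok_chk.b x (wr 0)) =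
      H (ok_chk.b (gpoly chk dTop rho x) y) + H (sOp chk x (wr 0)) := by
    rw [ok_chk.b_comm y, H_add gry (ok_chk.good gx gr1)]; rfl
  have hd := dual gx gr1
  rw [mr1, hx.univ, zero_mul, zero_add, one_mul] at hd
  have total := (((lR.const_mul ((derivative L).eval 1 / (derivative R).eval 1)).add
    (lr.const_mul ((derivative L).eval 1))).sub (lx.const_mul ((derivative L).eval 1))).sub lc
  rw [vR, vc, vx] at total
  have hz : (derivative L).eval 1 / (derivative R).eval 1 *
      ((derivative R).eval 1 * H (ok_chk.b (gpoly chk dTop rho x) y)) +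
      (derivative L).eval 1 * H (wr 0) -
      (derivative L).eval 1 * (H (ok_chk.b (gpoly chk dTop rho x) y) + H (sOp chk x (wr 0))) -
      (derivative L).eval 1 * H (sOp add2 x (wr 0)) = 0 := by
    rw [← hd]
    field_simp
    ring
  rw [hz] at total
  refine total.congr fun t => ?_
  simp only [potU, polyCheck_eq, polyConv_eq, sConv_eq, sCheck_eq, OkMap.b_eq]
  ring

end SCLDPC
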